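/- arXiv:2403.17464 — 2 statements merged into one kernel-verified Lean document; each statement's English description precedes it below -/
import Mathlib

section
/- Let β > 0, ε ∈ ℝ and d ≥ 1. There exists a constant C < ∞ depending only on β and ε such that for all φ, ξ ∈ ℝ^d with (φ,ξ) ≠ (0,0) and all t ∈ ℝ, one has ∫_{−∞}^t K(t,s,φ,ξ) · W(s,φ,ξ)^{2β−ε} ds ≤ C · W(t,φ,ξ)^{−ε}. -/
open MeasureTheory Real

/-- The weight `W(t,φ,ξ) = max(‖ξ - tφ‖, ‖φ‖^{1/(1+2β)})`. -/
noncomputable def Wgt (β : ℝ) {d : ℕ} (t : ℝ) (φ ξ : EuclideanSpace ℝ (Fin d)) : ℝ :=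
  max ‖ξ - t • φ‖ (‖φ‖ ^ (1 / (1 + 2 * β)))

/-- The Kolmogorov kernel `K(t,s,φ,ξ) = exp(-∫_s^t ‖ξ - τφ‖^{2β} dτ)`. -/
noncomputable def Kker (β : ℝ) {d : ℕ} (t s : ℝ) (φ ξ : EuclideanSpace ℝ (Fin d)) : ℝ :=
  Real.exp (-(∫ τ in s..t, ‖ξ - τ • φ‖ ^ (2 * β)))

/-- Along a line traversed at velocity `φ` for a time `t - s`, the integral of `‖·‖^r` is at least
that of a segment centred at the origin, up to a constant. -/
theorem le_integral_norm_sub_smul_rpow {d : ℕ} {r : ℝ} (hr : 0 ≤ r)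
    (φ ξ : EuclideanSpace ℝ (Fin d)) {s t : ℝ} (hst : s ≤ t) :
    (t - s) / 2 * (‖φ‖ * (t - s) / 4) ^ r ≤ ∫ τ in s..t, ‖ξ - τ • φ‖ ^ r := by
  set f : ℝ → ℝ := fun τ => ‖ξ - τ • φ‖ ^ r with hf
  have hfc : Continuous f := by
    refine Continuous.rpow_const (by fun_prop) (fun _ => Or.inr hr)
  set h : ℝ := (t - s) / 2 with hh
  have hfhc : Continuous fun τ => f (τ + h) := by fun_prop
  have hh0 : 0 ≤ h := by rw [hh]; linarith
  have hsplit : ∫ τ in s..t, f τ = ∫ τ in s..(s + h), (f τ + f (τ + h)) := by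
    rw [intervalIntegral.integral_add (hfc.intervalIntegrable _ _)
      (hfhc.intervalIntegrable _ _),
      intervalIntegral.integral_comp_add_right f h]
    have : s + h + h = t := by rw [hh]; ring
    rw [this, intervalIntegral.integral_add_adjacent_intervals
      (hfc.intervalIntegrable _ _) (hfc.intervalIntegrable _ _)]
  have hpt (τ : ℝ) : (‖φ‖ * (t - s) / 4) ^ r ≤ f τ + f (τ + h) := by
    have htri : ‖φ‖ * h ≤ ‖ξ - τ • φ‖ + ‖ξ - (τ + h) • φ‖ := by
      have e : h • φ = (ξ - τ • φ) - (ξ - (τ + h) • φ) := by module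
      calc ‖φ‖ * h = ‖h • φ‖ := by rw [norm_smul, Real.norm_of_nonneg hh0, mul_comm]
        _ ≤ _ := by rw [e]; exact norm_sub_le _ _
    have hq : ‖φ‖ * (t - s) / 4 = ‖φ‖ * h / 2 := by rw [hh]; ring
    have h0 : 0 ≤ ‖φ‖ * h / 2 := by positivity
    have h1 : 0 ≤ f τ := by positivity
    have h2 : 0 ≤ f (τ + h) := by positivity
    rw [hq]
    rcases le_total (‖φ‖ * h / 2) ‖ξ - τ • φ‖ with hc | hc
    · have : (‖φ‖ * h / 2) ^ r ≤ f τ := Real.rpow_le_rpow h0 hc hr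
      linarith
    · have : (‖φ‖ * h / 2) ^ r ≤ f (τ + h) := Real.rpow_le_rpow h0 (by linarith) hr
      linarith
  have hmono := intervalIntegral.integral_mono_on (a := s) (b := s + h) (μ := volume)
    (by linarith) (intervalIntegrable_const (c := (‖φ‖ * (t - s) / 4) ^ r))
    ((hfc.add hfhc).intervalIntegrable _ _)
    (fun τ _ => hpt τ)
  rw [intervalIntegral.integral_const, smul_eq_mul, add_sub_cancel_left] at hmono
  exact hmono.trans_eq hsplit.symm

section Weight

variable {β : ℝ} {d : ℕ} {φ ξ : EuclideanSpace ℝ (Fin d)}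

theorem Wgt_pos (h : (φ, ξ) ≠ (0, 0)) (t : ℝ) : 0 < Wgt β t φ ξ := by
  by_cases hφ : φ = 0
  · have hξ : ξ ≠ 0 := fun hξ => h (by rw [hφ, hξ])
    refine lt_max_of_lt_left ?_
    simpa [hφ] using hξ
  · exact lt_max_of_lt_right (Real.rpow_pos_of_pos (norm_pos_iff.mpr hφ) _)

theorem rpow_one_div_rpow_mul_self (hβ : 0 < β) {x : ℝ} (hx : 0 ≤ x) :
    (x ^ (1 / (1 + 2 * β))) ^ (2 * β) * x ^ (1 / (1 + 2 * β)) = x := by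
  have h0 : 0 ≤ x ^ (1 / (1 + 2 * β)) := by positivity
  have h1 : 1 + 2 * β ≠ 0 := by positivity
  nth_rewrite 2 [← Real.rpow_one (x ^ (1 / (1 + 2 * β)))]
  rw [← Real.rpow_add_of_nonneg h0 (by positivity) zero_le_one, ← Real.rpow_mul hx,
    add_comm (2 * β), one_div_mul_cancel h1, Real.rpow_one]

theorem norm_le_Wgt_rpow_mul (hβ : 0 < β) (t : ℝ) :
    ‖φ‖ ≤ Wgt β t φ ξ ^ (2 * β) * ‖φ‖ ^ (1 / (1 + 2 * β)) := by
  have h0 : 0 ≤ ‖φ‖ ^ (1 / (1 + 2 * β)) := by positivity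
  calc ‖φ‖ = (‖φ‖ ^ (1 / (1 + 2 * β))) ^ (2 * β) * ‖φ‖ ^ (1 / (1 + 2 * β)) :=
        (rpow_one_div_rpow_mul_self hβ (norm_nonneg _)).symm
    _ ≤ _ := mul_le_mul_of_nonneg_right
        (Real.rpow_le_rpow h0 (le_max_right _ _) (by positivity)) h0

theorem norm_sub_smul_le_add {s t : ℝ} (hst : s ≤ t) :
    ‖ξ - s • φ‖ ≤ ‖ξ - t • φ‖ + ‖φ‖ * (t - s) := by
  have e : ξ - s • φ = (ξ - t • φ) + (t - s) • φ := by module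
  rw [e]
  refine (norm_add_le _ _).trans_eq ?_
  rw [norm_smul, Real.norm_of_nonneg (sub_nonneg.mpr hst), mul_comm]

theorem norm_sub_smul_sub_le {s t : ℝ} (hst : s ≤ t) :
    ‖ξ - t • φ‖ - ‖φ‖ * (t - s) ≤ ‖ξ - s • φ‖ := by
  have e : ξ - t • φ = (ξ - s • φ) - (t - s) • φ := by module
  have := norm_sub_le (ξ - s • φ) ((t - s) • φ)
  rw [← e, norm_smul, Real.norm_of_nonneg (sub_nonneg.mpr hst)] at this
  linarith

theorem Wgt_le_mul (hβ : 0 < β) {s t : ℝ} (hst : s ≤ t) :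
    Wgt β s φ ξ ≤ Wgt β t φ ξ * (1 + Wgt β t φ ξ ^ (2 * β) * (t - s)) := by
  have hT : 0 ≤ t - s := sub_nonneg.mpr hst
  have hM : 0 ≤ Wgt β t φ ξ := (norm_nonneg _).trans (le_max_left _ _)
  have hφ : ‖φ‖ ≤ Wgt β t φ ξ ^ (2 * β) * Wgt β t φ ξ :=
    (norm_le_Wgt_rpow_mul (ξ := ξ) hβ t).trans
      (mul_le_mul_of_nonneg_left (le_max_right _ _) (by positivity))
  have h1 : ‖ξ - t • φ‖ ≤ Wgt β t φ ξ := le_max_left _ _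
  have h2 : ‖φ‖ ^ (1 / (1 + 2 * β)) ≤ Wgt β t φ ξ := le_max_right _ _
  have h3 := mul_le_mul_of_nonneg_right hφ hT
  have h4 : 0 ≤ Wgt β t φ ξ ^ (2 * β) * Wgt β t φ ξ * (t - s) := by positivity
  refine max_le ((norm_sub_smul_le_add hst).trans ?_) ?_ <;> linarith

theorem Wgt_le_two_mul (hβ : 0 < β) {s t : ℝ} (hst : s ≤ t) :
    Wgt β t φ ξ ≤ 2 * (1 + Wgt β t φ ξ ^ (2 * β) * (t - s)) * Wgt β s φ ξ := by
  have hT : 0 ≤ t - s := sub_nonneg.mpr hst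
  have hM : 0 ≤ Wgt β t φ ξ := (norm_nonneg _).trans (le_max_left _ _)
  have hS : 0 ≤ Wgt β s φ ξ := (norm_nonneg _).trans (le_max_left _ _)
  have hx : 0 ≤ Wgt β t φ ξ ^ (2 * β) * (t - s) := by positivity
  have hS1 : ‖ξ - s • φ‖ ≤ Wgt β s φ ξ := le_max_left _ _
  have hS2 : ‖φ‖ ^ (1 / (1 + 2 * β)) ≤ Wgt β s φ ξ := le_max_right _ _
  have hxS := mul_nonneg hx hS
  rcases le_total ‖ξ - t • φ‖ (‖φ‖ ^ (1 / (1 + 2 * β))) with hc | hc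
  · have hMe : Wgt β t φ ξ = ‖φ‖ ^ (1 / (1 + 2 * β)) := max_eq_right hc
    linarith
  · have hMe : Wgt β t φ ξ = ‖ξ - t • φ‖ := max_eq_left hc
    have h1 := norm_sub_smul_sub_le (φ := φ) (ξ := ξ) hst
    rcases le_total (‖φ‖ * (t - s)) (Wgt β t φ ξ / 2) with hd | hd
    · linarith
    · have h2 := mul_le_mul_of_nonneg_right (norm_le_Wgt_rpow_mul (φ := φ) (ξ := ξ) hβ t) hT
      have h3 := mul_le_mul_of_nonneg_left hS2 hx
      linarith

theorem le_integral_of_Wgt (hβ : 0 < β) {s t : ℝ} (hst : s ≤ t) :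
    1 / 2 * (1 / 8) ^ (2 * β) * (Wgt β t φ ξ ^ (2 * β) * (t - s)) - 1 ≤
      ∫ τ in s..t, ‖ξ - τ • φ‖ ^ (2 * β) := by
  have hT : 0 ≤ t - s := sub_nonneg.mpr hst
  have hM : 0 ≤ Wgt β t φ ξ := (norm_nonneg _).trans (le_max_left _ _)
  have hβ2 : 0 ≤ 2 * β := by positivity
  have hx : 0 ≤ Wgt β t φ ξ ^ (2 * β) * (t - s) := by positivity
  have hmul : 1 / 2 * (1 / 8) ^ (2 * β) * (Wgt β t φ ξ ^ (2 * β) * (t - s)) =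
      (t - s) / 2 * (Wgt β t φ ξ / 8) ^ (2 * β) := by
    rw [div_eq_mul_one_div (Wgt β t φ ξ) 8, Real.mul_rpow hM (by norm_num)]
    ring
  rcases le_total (Wgt β t φ ξ / 2) (‖φ‖ * (t - s)) with hd | hd
  · have h1 := le_integral_norm_sub_smul_rpow hβ2 φ ξ hst
    have h2 : (Wgt β t φ ξ / 8) ^ (2 * β) ≤ (‖φ‖ * (t - s) / 4) ^ (2 * β) :=
      Real.rpow_le_rpow (by positivity) (by linarith) hβ2
    have h3 := mul_le_mul_of_nonneg_left h2 (by linarith : 0 ≤ (t - s) / 2)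
    linarith
  · rcases le_total ‖ξ - t • φ‖ (‖φ‖ ^ (1 / (1 + 2 * β))) with hc | hc
    · have hMe : Wgt β t φ ξ = ‖φ‖ ^ (1 / (1 + 2 * β)) := max_eq_right hc
      have hint : 0 ≤ ∫ τ in s..t, ‖ξ - τ • φ‖ ^ (2 * β) :=
        intervalIntegral.integral_nonneg hst (fun _ _ => by positivity)
      have hφ : Wgt β t φ ξ ^ (2 * β) * Wgt β t φ ξ = ‖φ‖ := by
        rw [hMe]; exact rpow_one_div_rpow_mul_self hβ (norm_nonneg _)
      have hx1 : Wgt β t φ ξ ^ (2 * β) * (t - s) ≤ 1 := by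
        rcases hM.eq_or_lt with h0 | h0
        · rw [← h0, Real.zero_rpow (by positivity)]; simp
        · rw [← hφ] at hd
          by_contra! hlt
          have := mul_lt_mul_of_pos_right hlt h0
          linarith
      have hc1 : (1 / 8 : ℝ) ^ (2 * β) ≤ 1 :=
        Real.rpow_le_one (by norm_num) (by norm_num) hβ2
      have := mul_le_mul hc1 hx1 hx zero_le_one
      linarith
    · have hMe : Wgt β t φ ξ = ‖ξ - t • φ‖ := max_eq_left hc
      have hfc : Continuous fun τ : ℝ => ‖ξ - τ • φ‖ ^ (2 * β) :=
        Continuous.rpow_const (by fun_prop) (fun _ => Or.inr hβ2)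
      have hmono := intervalIntegral.integral_mono_on (a := s) (b := t) (μ := volume) hst
        (intervalIntegrable_const (c := (Wgt β t φ ξ / 8) ^ (2 * β)))
        (hfc.intervalIntegrable _ _) (fun τ hτ => by
          have h1 := norm_sub_smul_sub_le (φ := φ) (ξ := ξ) hτ.2
          have h2 : ‖φ‖ * (t - τ) ≤ ‖φ‖ * (t - s) :=
            mul_le_mul_of_nonneg_left (by linarith [hτ.1]) (norm_nonneg _)
          exact Real.rpow_le_rpow (by positivity) (by linarith) hβ2)
      rw [intervalIntegral.integral_const, smul_eq_mul] at hmono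
      have : 0 ≤ (t - s) * (Wgt β t φ ξ / 8) ^ (2 * β) := by positivity
      linarith

end Weight

theorem rpow_le_rpow_abs_mul {a b y : ℝ} (ha : 0 < a) (hb : 0 < b) (hy : 0 < y)
    (hba : b ≤ y * a) (hab : a ≤ y * b) (p : ℝ) : b ^ p ≤ y ^ |p| * a ^ p := by
  rcases le_total 0 p with hp | hp
  · rw [abs_of_nonneg hp, ← Real.mul_rpow hy.le ha.le]
    exact Real.rpow_le_rpow hb.le hba hp
  · have h := Real.rpow_le_rpow_of_nonpos ha hab hp
    rw [Real.mul_rpow hy.le hb.le] at h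
    calc b ^ p = y ^ |p| * (y ^ p * b ^ p) := by
          rw [abs_of_nonpos hp, ← mul_assoc, ← Real.rpow_add hy]; simp
      _ ≤ _ := mul_le_mul_of_nonneg_left h (by positivity)

theorem exists_rpow_le_mul_exp {c q : ℝ} (hc : 0 < c) (hq : 0 ≤ q) :
    ∃ A : ℝ, 0 ≤ A ∧ ∀ x : ℝ, 0 ≤ x → (2 * (1 + x)) ^ q ≤ A * Real.exp (c * x) := by
  set k : ℝ := min 1 (c / (q + 1)) with hk
  have hk0 : 0 < k := lt_min one_pos (by positivity)
  have hkq : k * q ≤ c := by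
    have h1 : k * (q + 1) ≤ c := by
      rw [← le_div_iff₀ (by positivity)]; exact min_le_right _ _
    linarith
  refine ⟨(2 / k) ^ q, by positivity, fun x hx => ?_⟩
  have h1 : 2 * (1 + x) ≤ 2 / k * Real.exp (k * x) := by
    have h2 := Real.add_one_le_exp (k * x)
    have h3 : k ≤ 1 := min_le_left _ _
    rw [div_mul_eq_mul_div, le_div_iff₀ hk0]
    linarith
  calc (2 * (1 + x)) ^ q ≤ (2 / k * Real.exp (k * x)) ^ q :=
        Real.rpow_le_rpow (by positivity) h1 hq
    _ = (2 / k) ^ q * Real.exp (k * q * x) := by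
        rw [Real.mul_rpow (by positivity) (Real.exp_pos _).le, ← Real.exp_mul]
        ring_nf
    _ ≤ _ := by gcongr

/-- Estimate (2.15): `∫_{-∞}^t K(t,s,φ,ξ) W(s,φ,ξ)^{2β-ε} ds ≲ W(t,φ,ξ)^{-ε}` with a
constant depending only on `β` and `ε`. -/
theorem kernel_weighted_integral_in_s (β ε : ℝ) (hβ : 0 < β) :
    ∃ C : ℝ,
      ∀ (d : ℕ), 1 ≤ d → ∀ φ ξ : EuclideanSpace ℝ (Fin d), (φ, ξ) ≠ (0, 0) →
        ∀ t : ℝ,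
          (∫ s in Set.Iic t, Kker β t s φ ξ * Wgt β s φ ξ ^ (2 * β - ε))
            ≤ C * Wgt β t φ ξ ^ (-ε) := by
  set c : ℝ := 1 / 2 * (1 / 8) ^ (2 * β) with hc
  have hc0 : 0 < c := by positivity
  obtain ⟨A, hA0, hA⟩ := exists_rpow_le_mul_exp (half_pos hc0) (abs_nonneg (2 * β - ε))
  refine ⟨Real.exp 1 * A / (c / 2), fun d _ φ ξ hne t => ?_⟩
  set M : ℝ := Wgt β t φ ξ with hM
  have hM0 : 0 < M := Wgt_pos hne t
  set a : ℝ := c / 2 * M ^ (2 * β) with ha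
  have ha0 : 0 < a := by positivity
  set B : ℝ := Real.exp 1 * A * M ^ (2 * β - ε) * Real.exp (-(a * t)) with hB
  have hbound : ∀ s ∈ Set.Iic t,
      Kker β t s φ ξ * Wgt β s φ ξ ^ (2 * β - ε) ≤ B * Real.exp (a * s) := by
    intro s hs
    have hst : s ≤ t := hs
    set x : ℝ := M ^ (2 * β) * (t - s) with hx
    have hx0 : 0 ≤ x := mul_nonneg (by positivity) (sub_nonneg.mpr hst)
    have hS0 : 0 < Wgt β s φ ξ := Wgt_pos hne s
    have hK : Kker β t s φ ξ ≤ Real.exp (1 - c * x) := by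
      refine Real.exp_le_exp.mpr ?_
      have := le_integral_of_Wgt (φ := φ) (ξ := ξ) hβ hst
      rw [← hM, ← hx, ← hc] at this
      linarith
    have hup : Wgt β s φ ξ ≤ 2 * (1 + x) * M := by
      have h1 : Wgt β s φ ξ ≤ M * (1 + x) := Wgt_le_mul hβ hst
      have h2 : 0 ≤ M * (1 + x) := by positivity
      linarith
    have hW := rpow_le_rpow_abs_mul hM0 hS0 (by positivity) hup
      (Wgt_le_two_mul hβ hst) (2 * β - ε)
    calc Kker β t s φ ξ * Wgt β s φ ξ ^ (2 * β - ε)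
        ≤ Real.exp (1 - c * x) * (A * Real.exp (c / 2 * x) * M ^ (2 * β - ε)) := by
          refine mul_le_mul hK (hW.trans ?_) (by positivity) (Real.exp_pos _).le
          exact mul_le_mul_of_nonneg_right (hA x hx0) (by positivity)
      _ = A * M ^ (2 * β - ε) * (Real.exp (1 - c * x) * Real.exp (c / 2 * x)) := by ring
      _ = A * M ^ (2 * β - ε) * (Real.exp 1 * Real.exp (-(a * t)) * Real.exp (a * s)) := by
          rw [← Real.exp_add, ← Real.exp_add, ← Real.exp_add, ha, hx]
          ring_nf
      _ = B * Real.exp (a * s) := by rw [hB]; ring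
  have hmono : (∫ s in Set.Iic t, Kker β t s φ ξ * Wgt β s φ ξ ^ (2 * β - ε)) ≤
      ∫ s in Set.Iic t, B * Real.exp (a * s) := by
    refine integral_mono_of_nonneg (Filter.Eventually.of_forall fun s => ?_)
      ((integrableOn_exp_mul_Iic ha0 t).const_mul B)
      ((ae_restrict_iff' measurableSet_Iic).mpr (Filter.Eventually.of_forall hbound))
    exact mul_nonneg (Real.exp_pos _).le (Real.rpow_nonneg (Wgt_pos hne s).le _)
  refine hmono.trans_eq ?_
  have hexp : Real.exp (-(a * t)) * Real.exp (a * t) = 1 := by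
    rw [← Real.exp_add]; simp
  have hpow : M ^ (2 * β - ε) = M ^ (2 * β) * M ^ (-ε) := by
    rw [← Real.rpow_add hM0, sub_eq_add_neg]
  rw [integral_const_mul, integral_exp_mul_Iic ha0, hB]
  calc Real.exp 1 * A * M ^ (2 * β - ε) * Real.exp (-(a * t)) * (Real.exp (a * t) / a)
      = Real.exp 1 * A * M ^ (2 * β - ε) / a * (Real.exp (-(a * t)) * Real.exp (a * t)) := by ring
    _ = Real.exp 1 * A / (c / 2) * M ^ (-ε) := by
        rw [hexp, hpow, ha]
        field_simp
end

section
/- Let β > 0, ε ∈ ℝ and d ≥ 1. There exists a constant C < ∞ depending only on β and ε such that for all φ, ξ ∈ ℝ^d with (φ,ξ) ≠ (0,0) and every measurable function f : ℝ → [0,∞], both of the following hold: (i) ∫_ℝ W(t,φ,ξ)^ε · (∫_{−∞}^t K(t,s,φ,ξ) · W(s,φ,ξ)^{2β−ε} · f(s) ds) dt ≤ C · ∫_ℝ f(s) ds; and (ii) if f(s) ≤ M for almost every s, then for every t ∈ ℝ one has W(t,φ,ξ)^ε · ∫_{−∞}^t K(t,s,φ,ξ) · W(s,φ,ξ)^{2β−ε}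 · f(s) ds ≤ C·M. -/
open MeasureTheory Real
open scoped ENNReal

/-- Integrating-factor estimate: if `|ε V'| ≤ (c/2) V^{2β+1}`, then the weight `V^{2β-ε}` damped by
`exp (-c ∫ V^{2β})` integrates to at most `(2/c) V(t)^{-ε}`. -/
theorem lintegral_exp_neg_mul_rpow_le {β ε c : ℝ} (hc : 0 < c) {V V' : ℝ → ℝ}
    (hV : ∀ x, HasDerivAt V (V' x) x) (hpos : ∀ x, 0 < V x)
    (h : ∀ x, |ε * V' x| ≤ c / 2 * V x ^ (2 * β + 1)) (t : ℝ) :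
    ∫⁻ s in Set.Iic t,
        ENNReal.ofReal (Real.exp (-(c * ∫ τ in s..t, V τ ^ (2 * β))) * V s ^ (2 * β - ε))
      ≤ ENNReal.ofReal (2 / c * V t ^ (-ε)) := by
  have hVc : Continuous V := continuous_iff_continuousAt.2 fun x => (hV x).continuousAt
  have hpow : ∀ p : ℝ, Continuous fun x => V x ^ p := fun p =>
    hVc.rpow_const fun x => Or.inl (hpos x).ne'
  have hI : ∀ x, HasDerivAt (fun s => ∫ τ in s..t, V τ ^ (2 * β)) (-V x ^ (2 * β)) x := fun x =>
    intervalIntegral.integral_hasDerivAt_left ((hpow _).intervalIntegrable _ _)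
      (hpow _).aestronglyMeasurable.stronglyMeasurableAtFilter (hpow _).continuousAt
  set F : ℝ → ℝ := fun s =>
    Real.exp (-(c * ∫ τ in s..t, V τ ^ (2 * β))) * V s ^ (2 * β - ε) with hF
  set G : ℝ → ℝ := fun s =>
    2 / c * (Real.exp (-(c * ∫ τ in s..t, V τ ^ (2 * β))) * V s ^ (-ε)) with hG
  have hIc : Continuous fun s => ∫ τ in s..t, V τ ^ (2 * β) :=
    continuous_iff_continuousAt.2 fun x => (hI x).continuousAt
  have hFc : Continuous F := (Real.continuous_exp.comp (hIc.const_mul c).neg).mul (hpow _)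
  have hF0 : ∀ s, 0 ≤ F s := fun s => mul_nonneg (Real.exp_pos _).le (Real.rpow_nonneg (hpos s).le _)
  have hGd := fun x => (((((hI x).const_mul c).neg).exp).mul
    ((hV x).rpow_const (p := -ε) (Or.inl (hpos x).ne'))).const_mul (2 / c)
  have hbound : ∀ s ≤ t, ∫ x in s..t, F x ≤ 2 / c * V t ^ (-ε) := by
    intro s hs
    have key := intervalIntegral.integral_le_sub_of_hasDeriv_right_of_le (φ := F) (g := G) hs
      (fun x _ => (hGd x).continuousAt.continuousWithinAt)
      (fun x _ => (hGd x).hasDerivWithinAt) (hFc.continuousOn.integrableOn_Icc) ?_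
    · have h1 : G t = 2 / c * V t ^ (-ε) := by simp [hG]
      have h2 : 0 ≤ G s := mul_nonneg (by positivity)
        (mul_nonneg (Real.exp_pos _).le (Real.rpow_nonneg (hpos s).le _))
      linarith
    · intro x _
      have e1 : V x ^ (2 * β - ε) = V x ^ (2 * β) * V x ^ (-ε) := by
        rw [← Real.rpow_add (hpos x)]; congr 1
      have e2 : V x ^ (2 * β + 1) * V x ^ (-ε - 1) = V x ^ (2 * β) * V x ^ (-ε) := by
        rw [← Real.rpow_add (hpos x), ← Real.rpow_add (hpos x)]; congr 1; ring
      have h3 : ε * V' x * V x ^ (-ε - 1) ≤ c / 2 * (V x ^ (2 * β) * V x ^ (-ε)) := by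
        rw [← e2, ← mul_assoc]
        exact mul_le_mul_of_nonneg_right ((le_abs_self _).trans (h x))
          (Real.rpow_nonneg (hpos x).le _)
      simp only [hF, e1]
      set X := Real.exp (-(c * ∫ τ in x..t, V τ ^ (2 * β)))
      have hX : 0 < X := Real.exp_pos _
      have h4 : X * (V x ^ (2 * β) * V x ^ (-ε)) = 2 / c *
          (X * (c * (V x ^ (2 * β) * V x ^ (-ε)) - c / 2 * (V x ^ (2 * β) * V x ^ (-ε)))) := by
        field_simp; ring
      rw [h4]
      refine mul_le_mul_of_nonneg_left ?_ (by positivity)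
      change _ ≤ X * -(c * -V x ^ (2 * β)) * V x ^ (-ε) + X * (V' x * -ε * V x ^ (-ε - 1))
      linarith [mul_le_mul_of_nonneg_left h3 hX.le]
  have hbot := Filter.eventually_le_atBot t
  have hint : IntegrableOn F (Set.Iic t) := by
    refine integrableOn_Iic_of_intervalIntegral_norm_bounded (l := Filter.atBot) (a := id)
      (2 / c * V t ^ (-ε)) t (fun i => hFc.integrableOn_Ioc) Filter.tendsto_id ?_
    filter_upwards [hbot] with s hs
    simpa [Real.norm_of_nonneg (hF0 _)] using hbound s hs
  rw [← ofReal_integral_eq_lintegral_ofReal hint (Filter.Eventually.of_forall hF0)]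
  refine ENNReal.ofReal_le_ofReal ?_
  refine le_of_tendsto (intervalIntegral_tendsto_integral_Iic t hint Filter.tendsto_id) ?_
  filter_upwards [hbot] with s hs using hbound s hs

section RegularizedWeight

variable {d : ℕ}

/-- A smooth substitute for the weight, regularized at scale `L`. -/
noncomputable def regWgt (L t : ℝ) (φ ξ : EuclideanSpace ℝ (Fin d)) : ℝ :=
  √(‖ξ - t • φ‖ ^ 2 + L ^ 2)

theorem norm_le_regWgt (L t : ℝ) (φ ξ : EuclideanSpace ℝ (Fin d)) :
    ‖ξ - t • φ‖ ≤ regWgt L t φ ξ :=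
  Real.le_sqrt_of_sq_le (by nlinarith [sq_nonneg L])

theorem le_regWgt (L t : ℝ) (φ ξ : EuclideanSpace ℝ (Fin d)) : L ≤ regWgt L t φ ξ :=
  Real.le_sqrt_of_sq_le (by nlinarith [sq_nonneg ‖ξ - t • φ‖])

theorem hasDerivAt_regWgt {L t : ℝ} {φ ξ : EuclideanSpace ℝ (Fin d)} (h : 0 < regWgt L t φ ξ) :
    HasDerivAt (fun x => regWgt L x φ ξ) (-inner ℝ (ξ - t • φ) φ / regWgt L t φ ξ) t := by
  have h1 : HasDerivAt (fun x : ℝ => ξ - x • φ) (-φ) t := by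
    simpa using ((hasDerivAt_id t).smul_const φ).const_sub ξ
  have h2 := (h1.norm_sq.add_const (L ^ 2)).sqrt (Real.sqrt_pos.1 h).ne'
  refine h2.congr_deriv ?_
  rw [inner_neg_right, mul_div_mul_left _ _ two_ne_zero, regWgt]

theorem abs_deriv_regWgt_le {L t : ℝ} {φ ξ : EuclideanSpace ℝ (Fin d)}
    (h : 0 < regWgt L t φ ξ) : |-inner ℝ (ξ - t • φ) φ / regWgt L t φ ξ| ≤ ‖φ‖ := by
  rw [abs_div, abs_neg, abs_of_pos h, div_le_iff₀ h, mul_comm]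
  exact (abs_real_inner_le_norm _ _).trans
    (mul_le_mul_of_nonneg_right (norm_le_regWgt L t φ ξ) (norm_nonneg _))

theorem regWgt_rpow_le {β L : ℝ} (hβ : 0 < β) (hL : 0 ≤ L) (t : ℝ)
    (φ ξ : EuclideanSpace ℝ (Fin d)) {M : ℝ} (h1 : ‖ξ - t • φ‖ ≤ M) (h2 : L ≤ M) :
    regWgt L t φ ξ ^ (2 * β) ≤ 2 ^ β * M ^ (2 * β) := by
  have hM : 0 ≤ M := hL.trans h2
  rw [regWgt, Real.rpow_mul (Real.sqrt_nonneg _), Real.rpow_mul hM, Real.rpow_two, Real.rpow_two,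
    Real.sq_sqrt (by positivity), ← Real.mul_rpow (by norm_num) (by positivity)]
  refine Real.rpow_le_rpow (by positivity) ?_ hβ.le
  nlinarith [pow_le_pow_left₀ (norm_nonneg _) h1 2, pow_le_pow_left₀ hL h2 2]

theorem exists_Icc_of_norm_sub_smul_lt {β L B : ℝ} (hB : 0 ≤ B)
    {φ : EuclideanSpace ℝ (Fin d)} (ξ : EuclideanSpace ℝ (Fin d))
    (h : L ^ (1 + 2 * β) = B * ‖φ‖) :
    ∃ a b : ℝ, a ≤ b ∧ (b - a) * L ^ (2 * β) ≤ 4 * B ∧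
      ∀ τ : ℝ, ‖ξ - τ • φ‖ < L → τ ∈ Set.Icc a b := by
  by_cases hS : ∃ τ₀ : ℝ, ‖ξ - τ₀ • φ‖ < L
  · obtain ⟨τ₀, h0⟩ := hS
    have hLpos : 0 < L := (norm_nonneg _).trans_lt h0
    have hφ : 0 < ‖φ‖ := by
      rcases (norm_nonneg φ).eq_or_lt with h' | h'
      · rw [← h', mul_zero] at h
        exact absurd h (Real.rpow_pos_of_pos hLpos _).ne'
      · exact h'
    have hR : 0 ≤ 2 * L / ‖φ‖ := by positivity
    refine ⟨τ₀ - 2 * L / ‖φ‖, τ₀ + 2 * L / ‖φ‖, by linarith, ?_, fun τ hτ => ?_⟩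
    · rw [Real.rpow_add hLpos, Real.rpow_one] at h
      have : (τ₀ + 2 * L / ‖φ‖ - (τ₀ - 2 * L / ‖φ‖)) * L ^ (2 * β)
          = 4 * (L * L ^ (2 * β)) / ‖φ‖ := by ring
      rw [this, h]
      apply le_of_eq
      field_simp
    · have h3 : |τ - τ₀| * ‖φ‖ ≤ 2 * L := by
        rw [← Real.norm_eq_abs, ← norm_smul]
        have : (τ - τ₀) • φ = (ξ - τ₀ • φ) - (ξ - τ • φ) := by rw [sub_smul]; abel
        rw [this]
        linarith [norm_sub_le (ξ - τ₀ • φ) (ξ - τ • φ)]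
      rw [← le_div_iff₀ hφ, abs_le] at h3
      exact ⟨by linarith [h3.1], by linarith [h3.2]⟩
  · push Not at hS
    exact ⟨0, 0, le_rfl, by simpa using hB, fun τ hτ => absurd hτ (hS τ).not_gt⟩

theorem continuous_norm_sub_smul_rpow {β : ℝ} (hβ : 0 < β) (φ ξ : EuclideanSpace ℝ (Fin d)) :
    Continuous fun τ : ℝ => ‖ξ - τ • φ‖ ^ (2 * β) :=
  (by fun_prop : Continuous fun τ : ℝ => ‖ξ - τ • φ‖).rpow_const fun _ => Or.inr (by positivity)

theorem integral_regWgt_le {β L B : ℝ} (hβ : 0 < β) (hL : 0 ≤ L) (hB : 0 ≤ B)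
    {φ : EuclideanSpace ℝ (Fin d)} (ξ : EuclideanSpace ℝ (Fin d))
    (h : L ^ (1 + 2 * β) = B * ‖φ‖) {s t : ℝ} (hst : s ≤ t) :
    (2 ^ β)⁻¹ * ∫ τ in s..t, regWgt L τ φ ξ ^ (2 * β)
      ≤ (∫ τ in s..t, ‖ξ - τ • φ‖ ^ (2 * β)) + 4 * B := by
  obtain ⟨a, b, hab, hlen, hmem⟩ := exists_Icc_of_norm_sub_smul_lt hB ξ h
  have hLp : 0 ≤ L ^ (2 * β) := Real.rpow_nonneg hL _
  have h2 : (0 : ℝ) < 2 ^ β := by positivity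
  set J : ℝ → ℝ := (Set.Icc a b).indicator fun _ => L ^ (2 * β) with hJ
  have hJ0 : ∀ τ, 0 ≤ J τ := fun τ => Set.indicator_nonneg (fun _ _ => hLp) τ
  have hJint : Integrable J := (integrable_indicator_iff measurableSet_Icc).2
    (continuous_const.integrableOn_Icc)
  have hVc : Continuous fun τ => regWgt L τ φ ξ ^ (2 * β) := by
    unfold regWgt
    exact (by fun_prop : Continuous fun τ : ℝ => √(‖ξ - τ • φ‖ ^ 2 + L ^ 2)).rpow_const
      fun _ => Or.inr (by positivity)
  have hrc := continuous_norm_sub_smul_rpow hβ φ ξ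
  have hJle : ∫ τ in s..t, J τ ≤ 4 * B := by
    rw [intervalIntegral.integral_of_le hst]
    calc ∫ τ in Set.Ioc s t, J τ ≤ ∫ τ, J τ :=
          setIntegral_le_integral hJint (Filter.Eventually.of_forall hJ0)
      _ = (b - a) * L ^ (2 * β) := by
          rw [hJ, integral_indicator measurableSet_Icc, setIntegral_const]
          simp [Measure.real, hab]
      _ ≤ 4 * B := hlen
  rw [← intervalIntegral.integral_const_mul]
  calc ∫ τ in s..t, (2 ^ β)⁻¹ * regWgt L τ φ ξ ^ (2 * β)
      ≤ ∫ τ in s..t, (‖ξ - τ • φ‖ ^ (2 * β) + J τ) := by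
        refine intervalIntegral.integral_mono_on hst ((hVc.const_mul _).intervalIntegrable _ _)
          ((hrc.intervalIntegrable _ _).add hJint.intervalIntegrable) fun τ _ => ?_
        rw [inv_mul_le_iff₀ h2]
        rcases lt_or_ge ‖ξ - τ • φ‖ L with hlt | hge
        · have : J τ = L ^ (2 * β) := Set.indicator_of_mem (hmem τ hlt) _
          rw [this]
          refine (regWgt_rpow_le hβ hL τ φ ξ hlt.le le_rfl).trans ?_
          have : 0 ≤ ‖ξ - τ • φ‖ ^ (2 * β) := by positivity
          gcongr
          linarith
        · refine (regWgt_rpow_le hβ hL τ φ ξ le_rfl hge).trans ?_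
          gcongr
          linarith [hJ0 τ]
    _ = (∫ τ in s..t, ‖ξ - τ • φ‖ ^ (2 * β)) + ∫ τ in s..t, J τ :=
        intervalIntegral.integral_add (hrc.intervalIntegrable _ _) hJint.intervalIntegrable
    _ ≤ _ := by linarith

end RegularizedWeight

theorem rpow_le_rpow_abs_mul_rpow {D W V : ℝ} (hD : 1 ≤ D) (hV : 0 < V) (hWV : W ≤ V)
    (hVW : V ≤ D * W) (p : ℝ) : W ^ p ≤ D ^ |p| * V ^ p := by
  have hD0 : 0 < D := by linarith
  have hW : 0 < W := pos_of_mul_pos_right (hV.trans_le hVW) hD0.le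
  rcases le_total 0 p with hp | hp
  · calc W ^ p ≤ 1 * V ^ p := by rw [one_mul]; exact Real.rpow_le_rpow hW.le hWV hp
      _ ≤ _ := by
        gcongr
        exact Real.one_le_rpow hD (abs_nonneg _)
  · have h1 : (D * W) ^ p ≤ V ^ p := Real.rpow_le_rpow_of_nonpos hV hVW hp
    rw [Real.mul_rpow hD0.le hW.le] at h1
    calc W ^ p = D ^ |p| * (D ^ p * W ^ p) := by
          rw [abs_of_nonpos hp, ← mul_assoc, ← Real.rpow_add hD0]; simp
      _ ≤ _ := by gcongr

theorem Wgt_nonneg (β : ℝ) {d : ℕ} (t : ℝ) (φ ξ : EuclideanSpace ℝ (Fin d)) :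
    0 ≤ Wgt β t φ ξ := (norm_nonneg _).trans (le_max_left _ _)

theorem exists_bound_lintegral_past (β ε : ℝ) (hβ : 0 < β) :
    ∃ C : ℝ≥0∞, C ≠ ⊤ ∧ ∀ (d : ℕ) (φ ξ : EuclideanSpace ℝ (Fin d)), (φ, ξ) ≠ (0, 0) → ∀ t : ℝ,
      ENNReal.ofReal (Wgt β t φ ξ ^ ε) * (∫⁻ s in Set.Iic t,
        ENNReal.ofReal (Kker β t s φ ξ * Wgt β s φ ξ ^ (2 * β - ε))) ≤ C := by
  set c : ℝ := (2 ^ β)⁻¹ with hcdef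
  have hc : 0 < c := by positivity
  set B : ℝ := max 1 (2 * |ε| / c) with hBdef
  have hB1 : 1 ≤ B := le_max_left _ _
  have hB0 : 0 ≤ B := by linarith
  have hBε : |ε| ≤ c / 2 * B := by
    have := (div_le_iff₀ hc).1 (le_max_right 1 (2 * |ε| / c))
    rw [← hBdef] at this
    linarith
  have hq : (0 : ℝ) < 1 + 2 * β := by linarith
  set A : ℝ := B ^ (1 / (1 + 2 * β)) with hAdef
  have hA1 : 1 ≤ A := Real.one_le_rpow hB1 (by positivity)
  have hA0 : 0 ≤ A := by linarith
  set D : ℝ := √(1 + A ^ 2) with hDdef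
  have hD1 : 1 ≤ D := Real.one_le_sqrt.2 (by nlinarith)
  have hD0 : 0 < D := by linarith
  set N : ℝ := D ^ |ε| * (Real.exp (4 * B) * D ^ |2 * β - ε|) with hN
  refine ⟨ENNReal.ofReal (N * (2 / c)), ENNReal.ofReal_ne_top, fun d φ ξ hne t => ?_⟩
  set l : ℝ := ‖φ‖ ^ (1 / (1 + 2 * β)) with hl
  have hl0 : 0 ≤ l := by positivity
  set L : ℝ := A * l with hLdef
  have hL0 : 0 ≤ L := by positivity
  have hLB : L ^ (1 + 2 * β) = B * ‖φ‖ := by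
    rw [hLdef, Real.mul_rpow hA0 hl0, hAdef, hl, ← Real.rpow_mul hB0,
      ← Real.rpow_mul (norm_nonneg _), one_div_mul_cancel hq.ne', Real.rpow_one, Real.rpow_one]
  set V : ℝ → ℝ := fun s => regWgt L s φ ξ with hVdef
  have hWpos : ∀ s, 0 < Wgt β s φ ξ := by
    intro s
    by_cases hφ : φ = 0
    · refine lt_max_of_lt_left (norm_pos_iff.2 ?_)
      subst hφ
      simpa using hne
    · exact lt_max_of_lt_right (Real.rpow_pos_of_pos (norm_pos_iff.2 hφ) _)
  have hWV : ∀ s, Wgt β s φ ξ ≤ V s := fun s => max_le (norm_le_regWgt _ _ _ _)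
    ((le_mul_of_one_le_left hl0 hA1).trans (le_regWgt _ _ _ _))
  have hVpos : ∀ s, 0 < V s := fun s => (hWpos s).trans_le (hWV s)
  have hVW : ∀ s, V s ≤ D * Wgt β s φ ξ := by
    intro s
    refine Real.sqrt_le_iff.2 ⟨mul_nonneg hD0.le (hWpos s).le, ?_⟩
    rw [mul_pow D, hDdef, Real.sq_sqrt (by positivity), hLdef, mul_pow]
    have h1 : ‖ξ - s • φ‖ ^ 2 ≤ Wgt β s φ ξ ^ 2 :=
      pow_le_pow_left₀ (norm_nonneg _) (le_max_left _ _) 2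
    have h2 : l ^ 2 ≤ Wgt β s φ ξ ^ 2 := pow_le_pow_left₀ hl0 (le_max_right _ _) 2
    nlinarith [mul_le_mul_of_nonneg_left h2 (sq_nonneg A)]
  have hderiv : ∀ x, |ε * (-inner ℝ (ξ - x • φ) φ / V x)| ≤ c / 2 * V x ^ (2 * β + 1) := by
    intro x
    rw [abs_mul]
    calc |ε| * |-inner ℝ (ξ - x • φ) φ / V x| ≤ (c / 2 * B) * ‖φ‖ :=
          mul_le_mul hBε (abs_deriv_regWgt_le (hVpos x)) (abs_nonneg _) (by positivity)
      _ = c / 2 * L ^ (2 * β + 1) := by rw [add_comm, hLB, mul_assoc]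
      _ ≤ _ := by
        gcongr
        exact le_regWgt _ _ _ _
  have hmain := lintegral_exp_neg_mul_rpow_le hc (V := V)
    (fun x => hasDerivAt_regWgt (hVpos x)) hVpos hderiv t
  have hker : ∀ s ∈ Set.Iic t, ENNReal.ofReal (Kker β t s φ ξ * Wgt β s φ ξ ^ (2 * β - ε)) ≤
      ENNReal.ofReal (Real.exp (4 * B) * D ^ |2 * β - ε|) * ENNReal.ofReal
        (Real.exp (-(c * ∫ τ in s..t, V τ ^ (2 * β))) * V s ^ (2 * β - ε)) := by
    intro s hs
    rw [← ENNReal.ofReal_mul (by positivity)]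
    refine ENNReal.ofReal_le_ofReal ?_
    have h1 : Kker β t s φ ξ ≤
        Real.exp (4 * B) * Real.exp (-(c * ∫ τ in s..t, V τ ^ (2 * β))) := by
      rw [Kker, ← Real.exp_add]
      refine Real.exp_le_exp.2 ?_
      have := integral_regWgt_le hβ hL0 hB0 ξ hLB hs
      simp only [hVdef]
      linarith
    have h2 := rpow_le_rpow_abs_mul_rpow hD1 (hVpos s) (hWV s) (hVW s) (2 * β - ε)
    calc _ ≤ _ := mul_le_mul h1 h2 (Real.rpow_nonneg (hWpos s).le _) (by positivity)
      _ = _ := by ring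
  calc _ ≤ ENNReal.ofReal (D ^ |ε| * V t ^ ε) *
        (ENNReal.ofReal (Real.exp (4 * B) * D ^ |2 * β - ε|) *
          ENNReal.ofReal (2 / c * V t ^ (-ε))) := by
        refine mul_le_mul' (ENNReal.ofReal_le_ofReal
          (rpow_le_rpow_abs_mul_rpow hD1 (hVpos t) (hWV t) (hVW t) ε)) ?_
        refine (setLIntegral_mono' measurableSet_Iic hker).trans ?_
        rw [lintegral_const_mul' _ _ ENNReal.ofReal_ne_top]
        gcongr
    _ = ENNReal.ofReal (N * (2 / c)) := by
        have hVt := Real.rpow_nonneg (hVpos t).le ε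
        rw [← ENNReal.ofReal_mul (by positivity), ← ENNReal.ofReal_mul (by positivity)]
        congr 1
        have : V t ^ ε * V t ^ (-ε) = 1 := by
          rw [← Real.rpow_add (hVpos t)]; simp
        rw [hN]
        linear_combination (D ^ |ε| * Real.exp (4 * B) * D ^ |2 * β - ε| * (2 / c)) * this

theorem Wgt_neg (β : ℝ) {d : ℕ} (t : ℝ) (φ ξ : EuclideanSpace ℝ (Fin d)) :
    Wgt β (-t) (-φ) ξ = Wgt β t φ ξ := by
  simp [Wgt]

theorem Kker_neg (β : ℝ) {d : ℕ} (t s : ℝ) (φ ξ : EuclideanSpace ℝ (Fin d)) :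
    Kker β (-s) (-t) (-φ) ξ = Kker β t s φ ξ := by
  have := intervalIntegral.integral_comp_neg (a := s) (b := t)
    fun τ => ‖ξ - τ • (-φ)‖ ^ (2 * β)
  rw [Kker, Kker, ← this]
  simp

theorem exists_bound_lintegral_future (β ε : ℝ) (hβ : 0 < β) :
    ∃ C : ℝ≥0∞, C ≠ ⊤ ∧ ∀ (d : ℕ) (φ ξ : EuclideanSpace ℝ (Fin d)), (φ, ξ) ≠ (0, 0) → ∀ s : ℝ,
      ENNReal.ofReal (Wgt β s φ ξ ^ (2 * β - ε)) * (∫⁻ t in Set.Ici s,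
        ENNReal.ofReal (Kker β t s φ ξ * Wgt β t φ ξ ^ ε)) ≤ C := by
  obtain ⟨C, hC, h⟩ := exists_bound_lintegral_past β (2 * β - ε) hβ
  refine ⟨C, hC, fun d φ ξ hne s => ?_⟩
  have key := h d (-φ) ξ (by simpa using hne) (-s)
  rw [Wgt_neg, sub_sub_cancel] at key
  rw [← (Measure.measurePreserving_neg volume).setLIntegral_comp_preimage_emb
    (MeasurableEquiv.neg ℝ).measurableEmbedding] at key
  simpa [Kker_neg, Wgt_neg] using key

theorem continuous_Wgt (β : ℝ) {d : ℕ} (φ ξ : EuclideanSpace ℝ (Fin d)) :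
    Continuous fun t => Wgt β t φ ξ := by
  unfold Wgt
  fun_prop

theorem continuous_Kker {β : ℝ} (hβ : 0 < β) {d : ℕ} (φ ξ : EuclideanSpace ℝ (Fin d)) :
    Continuous fun p : ℝ × ℝ => Kker β p.1 p.2 φ ξ := by
  have hi : ∀ a b : ℝ, IntervalIntegrable (fun τ : ℝ => ‖ξ - τ • φ‖ ^ (2 * β)) volume a b :=
    fun a b => (continuous_norm_sub_smul_rpow hβ φ ξ).intervalIntegrable a b
  have hp := intervalIntegral.continuous_primitive hi 0
  have : (fun p : ℝ × ℝ => Kker β p.1 p.2 φ ξ) = fun p : ℝ × ℝ =>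
      Real.exp (-((∫ τ in (0 : ℝ)..p.1, ‖ξ - τ • φ‖ ^ (2 * β)) -
        ∫ τ in (0 : ℝ)..p.2, ‖ξ - τ • φ‖ ^ (2 * β))) := by
    ext p
    rw [Kker, intervalIntegral.integral_interval_sub_left (hi _ _) (hi _ _)]
  rw [this]
  exact Real.continuous_exp.comp ((hp.comp continuous_fst).sub (hp.comp continuous_snd)).neg

/-- Proposition 2.18 (L¹–L¹ and L∞–L∞ bounds for `W^ε T W^{2β-ε}`): with a constant
`C < ∞` depending only on `β` and `ε`, for every `(φ,ξ) ≠ (0,0)` and every measurable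
`f : ℝ → [0,∞]`, both the `L¹` bound (i) and the pointwise `L∞` bound (ii) hold. -/
theorem weighted_duhamel_L1_and_Linfty (β ε : ℝ) (hβ : 0 < β) :
    ∃ C : ℝ≥0∞, C ≠ ⊤ ∧
      ∀ (d : ℕ), 1 ≤ d → ∀ φ ξ : EuclideanSpace ℝ (Fin d), (φ, ξ) ≠ (0, 0) →
        ∀ f : ℝ → ℝ≥0∞, Measurable f →
          ((∫⁻ t : ℝ, ENNReal.ofReal (Wgt β t φ ξ ^ ε) *
              ∫⁻ s in Set.Iic t,
                ENNReal.ofReal (Kker β t s φ ξ * Wgt β s φ ξ ^ (2 * β - ε)) * f s)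
            ≤ C * ∫⁻ s : ℝ, f s) ∧
          ∀ M : ℝ≥0∞, (∀ᵐ s ∂(volume : Measure ℝ), f s ≤ M) →
            ∀ t : ℝ,
              ENNReal.ofReal (Wgt β t φ ξ ^ ε) *
                  (∫⁻ s in Set.Iic t,
                    ENNReal.ofReal (Kker β t s φ ξ * Wgt β s φ ξ ^ (2 * β - ε)) * f s)
                ≤ C * M := by
  obtain ⟨C₁, hC₁, h₁⟩ := exists_bound_lintegral_future β ε hβ
  obtain ⟨C₂, hC₂, h₂⟩ := exists_bound_lintegral_past β ε hβ
  refine ⟨max C₁ C₂, (max_lt hC₁.lt_top hC₂.lt_top).ne, fun d _ φ ξ hne f hf => ⟨?_, ?_⟩⟩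
  · have hWm : ∀ p : ℝ, Measurable fun t => ENNReal.ofReal (Wgt β t φ ξ ^ p) := fun p =>
      ((continuous_Wgt β φ ξ).measurable.pow_const p).ennreal_ofReal
    have hKm : Measurable fun p : ℝ × ℝ => ENNReal.ofReal (Kker β p.1 p.2 φ ξ) :=
      (continuous_Kker hβ φ ξ).measurable.ennreal_ofReal
    have hsplit : ∀ t s r p : ℝ, ENNReal.ofReal (Kker β t s φ ξ * Wgt β r φ ξ ^ p) =
        ENNReal.ofReal (Kker β t s φ ξ) * ENNReal.ofReal (Wgt β r φ ξ ^ p) := fun t s r p =>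
      ENNReal.ofReal_mul (Real.exp_pos _).le
    set H : ℝ → ℝ → ℝ≥0∞ := fun t s => {p : ℝ × ℝ | p.2 ≤ p.1}.indicator
      (fun p => ENNReal.ofReal (Wgt β p.1 φ ξ ^ ε) * (ENNReal.ofReal (Kker β p.1 p.2 φ ξ) *
        ENNReal.ofReal (Wgt β p.2 φ ξ ^ (2 * β - ε)) * f p.2)) (t, s) with hH
    have hHm : Measurable (Function.uncurry H) :=
      (((hWm ε).comp measurable_fst).mul ((hKm.mul ((hWm _).comp measurable_snd)).mul
        (hf.comp measurable_snd))).indicator (measurableSet_le measurable_snd measurable_fst)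
    calc _ = ∫⁻ t, ∫⁻ s, H t s := by
          refine lintegral_congr fun t => ?_
          rw [← lintegral_const_mul' _ _ ENNReal.ofReal_ne_top,
            ← lintegral_indicator measurableSet_Iic]
          refine lintegral_congr fun s => ?_
          simp only [hsplit, hH, Set.indicator_apply, Set.mem_Iic, Set.mem_ofPred_eq]
      _ = ∫⁻ s, ∫⁻ t, H t s := lintegral_lintegral_swap hHm.aemeasurable
      _ ≤ ∫⁻ s, max C₁ C₂ * f s := by
          refine lintegral_mono fun s => ?_
          have hm : Measurable fun t => ENNReal.ofReal (Kker β t s φ ξ * Wgt β t φ ξ ^ ε) := by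
            simp only [hsplit]
            exact (hKm.comp (measurable_id.prodMk measurable_const)).mul (hWm ε)
          calc ∫⁻ t, H t s = ENNReal.ofReal (Wgt β s φ ξ ^ (2 * β - ε)) * (∫⁻ t in Set.Ici s,
                ENNReal.ofReal (Kker β t s φ ξ * Wgt β t φ ξ ^ ε)) * f s := by
                rw [← lintegral_const_mul _ hm, ← lintegral_mul_const _ (hm.const_mul _),
                  ← lintegral_indicator measurableSet_Ici]
                refine lintegral_congr fun t => ?_
                simp only [hsplit, hH, Set.indicator_apply, Set.mem_Ici, Set.mem_ofPred_eq]
                split_ifs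
                · ring
                · rfl
            _ ≤ _ := by
                gcongr
                exact (h₁ d φ ξ hne s).trans (le_max_left _ _)
      _ = _ := lintegral_const_mul _ hf
  · intro M hM t
    have hm : Measurable fun s => ENNReal.ofReal (Kker β t s φ ξ * Wgt β s φ ξ ^ (2 * β - ε)) :=
      (((continuous_Kker hβ φ ξ).measurable.comp (measurable_const.prodMk measurable_id)).mul
        ((continuous_Wgt β φ ξ).measurable.pow_const _)).ennreal_ofReal
    calc _ ≤ ENNReal.ofReal (Wgt β t φ ξ ^ ε) * ∫⁻ s in Set.Iic t,
          ENNReal.ofReal (Kker β t s φ ξ * Wgt β s φ ξ ^ (2 * β - ε)) * M := by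
          gcongr 1
          refine lintegral_mono_ae ?_
          filter_upwards [ae_restrict_of_ae hM] with s hs
          gcongr
      _ = ENNReal.ofReal (Wgt β t φ ξ ^ ε) * (∫⁻ s in Set.Iic t,
          ENNReal.ofReal (Kker β t s φ ξ * Wgt β s φ ξ ^ (2 * β - ε))) * M := by
          rw [lintegral_mul_const _ hm, mul_assoc]
      _ ≤ _ := by
          gcongr
          exact (h₂ d φ ξ hne t).trans (le_max_right _ _)
end
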